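/- There are no integers a, b, c with a even, a ≥ 6, 0 ≤ b ≤ c and b + c ≥ 1 such that a² + 2ab + b² + 2ac − 10a − 10b − 3c = 0. -/

import Mathlib

theorem stmt_1 :
    ¬ ∃ a b c : ℤ, Even a ∧ a ≥ 6 ∧ 0 ≤ b ∧ b ≤ c ∧ b + c ≥ 1 ∧
      a^2 + 2*a*b + b^2 + 2*a*c - 10*a - 10*b - 3*c = 0 := by
  rintro ⟨a, b, c, ⟨k, rfl⟩, ha, hb, hbc, hc, h⟩
  have hs : k + k + b < 10 := by
    by_contra! hs
    nlinarith [mul_nonneg (by linarith : 0 ≤ k + k + b) (sub_nonneg.2 hs),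
      mul_pos (by omega : 0 < c) (by omega : 0 < 2 * (k + k) - 3)]
  have hk : k < 5 := by omega
  have hk' : 3 ≤ k := by omega
  have hb' : b < 4 := by omega
  interval_cases k <;> interval_cases b <;> omega
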